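/- arXiv:1702.05641 — 4 statements merged into one kernel-verified Lean document; each statement's English description precedes it below -/
import Mathlib

section
/- Let $F$ and $G$ be continuous distribution functions and $x_0 \in \mathbb{R}$ with $F(x) < 1$ and $G(x) < 1$ for $x \ge x_0$. Then $G_q(x) \ge F_q(x)$ for all $x > q \ge x_0$ if and only if the function $x \mapsto \frac{1-G(x)}{1-F(x)}$ is nonincreasing for $x > x_0$. -/
open MeasureTheory Filter

/-- `F` is a continuous (cumulative) distribution function. -/
def IsContinuousDF (F : ℝ → ℝ) : Prop :=
  Monotone F ∧ Continuous F ∧ Tendsto F atBot (nhds 0) ∧ Tendsto F atTop (nhds 1)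

/-- The order between two normalized increments is the reverse of that between the ratios
of the complements. -/
lemma sub_div_one_sub_le_iff {a b c d : ℝ} (ha : a < 1) (hb : b < 1) (hc : c < 1) :
    (b - a) / (1 - a) ≤ (d - c) / (1 - c) ↔ (1 - d) / (1 - b) ≤ (1 - c) / (1 - a) := by
  rw [div_le_div_iff₀ (sub_pos.2 ha) (sub_pos.2 hc),
    div_le_div_iff₀ (sub_pos.2 hb) (sub_pos.2 ha)]
  constructor <;> intro h <;> linarith

/-- A function that is antitone on an open ray and continuous from the right at its endpoint
is antitone on the closed ray. -/
lemma AntitoneOn.Ici_of_Ioi {f : ℝ → ℝ} {a : ℝ} (hf : AntitoneOn f (Set.Ioi a))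
    (hc : ContinuousWithinAt f (Set.Ioi a) a) : AntitoneOn f (Set.Ici a) := by
  intro x hx y hy hxy
  rcases (Set.mem_Ici.1 hx).eq_or_lt with rfl | hax
  · rcases hxy.eq_or_lt with rfl | hay
    · exact le_rfl
    · refine ge_of_tendsto hc ?_
      filter_upwards [Ioo_mem_nhdsGT hay] with z hz
      exact hf hz.1 hay hz.2.le
  · exact hf hax (hax.trans_le hxy) hxy

/-- **Proposition 1 (iii).** For continuous distribution functions `F` and `G` with
`F(x) < 1` and `G(x) < 1` for `x ≥ x₀`: `G_q(x) ≥ F_q(x)` for all `x > q ≥ x₀` if and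
only if `x ↦ (1-G(x))/(1-F(x))` is nonincreasing for `x > x₀`. -/
theorem Gq_ge_Fq_iff_ratio_antitone
    (F G : ℝ → ℝ) (hF : IsContinuousDF F) (hG : IsContinuousDF G)
    (x₀ : ℝ) (hlt : ∀ x, x₀ ≤ x → F x < 1 ∧ G x < 1) :
    (∀ q x, x₀ ≤ q → q < x →
        (F x - F q) / (1 - F q) ≤ (G x - G q) / (1 - G q)) ↔
      AntitoneOn (fun x => (1 - G x) / (1 - F x)) (Set.Ioi x₀) := by
  constructor
  · intro h q hq x hx hqx
    rcases hqx.eq_or_lt with rfl | hqx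
    · exact le_rfl
    · have hq' := hlt q (Set.mem_Ioi.1 hq).le
      have hx' := hlt x (Set.mem_Ioi.1 hx).le
      exact (sub_div_one_sub_le_iff hq'.1 hx'.1 hq'.2).1
        (h q x (Set.mem_Ioi.1 hq).le hqx)
  · intro h q x hq hqx
    have hx := hq.trans hqx.le
    have hc : ContinuousAt (fun x => (1 - G x) / (1 - F x)) x₀ :=
      (continuous_const.sub hG.2.1).continuousAt.div
        (continuous_const.sub hF.2.1).continuousAt (sub_pos.2 (hlt x₀ le_rfl).1).ne'
    exact (sub_div_one_sub_le_iff (hlt q hq).1 (hlt x hx).1 (hlt q hq).2).2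
      (h.Ici_of_Ioi hc.continuousWithinAt hq hx hqx.le)
end

section
/- Let $F_0$ and $F_1$ be continuous distribution functions satisfying condition $B(F_0,F_1)$ with constants $\varepsilon \in (0,1)$ and $x_0$, and let $q > x_0$ with $F_0(q)<1$ and $F_1(q)<1$. Let $X^*$ be a random variable with the tail distribution function $(F_1)_q$ linked with $F_1$, and set $Y = \ln(1-F_0(q)) - \ln(1-F_0(X^*))$. Then $P(Y \le x) \le 1 - e^{-(1-\varepsilon)x}$ for all $x \ge 0$; that is, $Y$ is stochastically larger than an exponential random variable with parameter $1-\varepsilon$. -/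
open MeasureTheory Filter

/-- Condition `B(F,G)` with constants `ε` and `x₀`:
`x ↦ (1 - G x) / (1 - F x)^(1-ε)` is nondecreasing for `x > x₀`. -/
def CondB (F G : ℝ → ℝ) (ε x₀ : ℝ) : Prop :=
  MonotoneOn (fun x => (1 - G x) / (1 - F x) ^ (1 - ε)) (Set.Ioi x₀)

/-- A closed sublevel set of a continuous distribution function at a level below `1` is contained
in a half-line `Iic z` whose endpoint still lies in the sublevel set. -/
theorem IsContinuousDF.exists_sublevel_endpoint {F : ℝ → ℝ} (hF : IsContinuousDF F) {c q : ℝ}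
    (hc : c < 1) (hq : F q ≤ c) : ∃ z, q ≤ z ∧ F z ≤ c ∧ ∀ y, F y ≤ c → y ≤ z := by
  obtain ⟨hmono, hcont, -, htop⟩ := hF
  obtain ⟨M, hM⟩ := (htop.eventually (lt_mem_nhds hc)).exists
  have hbdd : BddAbove {y | F y ≤ c} := by
    refine ⟨M, fun y hy => ?_⟩
    by_contra! h
    exact absurd (hmono h.le) (not_le.mpr (lt_of_le_of_lt hy hM))
  have hclosed : IsClosed {y | F y ≤ c} := isClosed_le hcont continuous_const
  exact ⟨sSup {y | F y ≤ c}, le_csSup hbdd hq, hclosed.csSup_mem ⟨q, hq⟩ hbdd,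
    fun y hy => le_csSup hbdd hy⟩

/-- Under condition `B(F,G)`, if `G q < 1` then `F` stays strictly below `1` to the right of `q`. -/
theorem CondB.lt_one {F G : ℝ → ℝ} {ε x₀ q y : ℝ} (hB : CondB F G ε x₀) (hF : IsContinuousDF F)
    (hε : ε < 1) (hq : x₀ < q) (hFq : F q < 1) (hGq : G q < 1) (hy : q ≤ y) : F y < 1 := by
  have hle : F y ≤ 1 := hF.1.ge_of_tendsto hF.2.2.2 y
  refine lt_of_le_of_ne hle fun h => ?_
  have hmono := hB (Set.mem_Ioi.mpr hq) (Set.mem_Ioi.mpr (hq.trans_le hy)) hy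
  simp only [h, sub_self, Real.zero_rpow (sub_pos.mpr hε).ne', div_zero] at hmono
  have hpos : 0 < (1 - G q) / (1 - F q) ^ (1 - ε) :=
    div_pos (sub_pos.mpr hGq) (Real.rpow_pos_of_pos (sub_pos.mpr hFq) _)
  linarith

/-- Condition `B(F,G)` bounds the tail of `G` linked at `q` from below. -/
theorem CondB.exp_le_tail_div {F G : ℝ → ℝ} {ε x₀ q z x : ℝ} (hB : CondB F G ε x₀)
    (hε : ε < 1) (hq : x₀ < q) (hFq : F q < 1) (hGq : G q < 1) (hz : q ≤ z)
    (hFz : (1 - F q) * Real.exp (-x) ≤ 1 - F z) :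
    Real.exp (-(1 - ε) * x) ≤ (1 - G z) / (1 - G q) := by
  have ha : 0 < 1 - F q := sub_pos.mpr hFq
  have hb : 0 < 1 - F z := (mul_pos ha (Real.exp_pos _)).trans_le hFz
  have hg : 0 < 1 - G q := sub_pos.mpr hGq
  have hmono := hB (Set.mem_Ioi.mpr hq) (Set.mem_Ioi.mpr (hq.trans_le hz)) hz
  have hA := Real.rpow_pos_of_pos ha (1 - ε)
  have hC := Real.rpow_pos_of_pos hb (1 - ε)
  simp only [div_le_div_iff₀ hA hC] at hmono
  have hpow := Real.rpow_le_rpow (by positivity) hFz (sub_pos.mpr hε).le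
  rw [Real.mul_rpow ha.le (Real.exp_pos _).le, ← Real.exp_mul,
    show -x * (1 - ε) = -(1 - ε) * x by ring] at hpow
  rw [le_div_iff₀ hg]
  refine le_of_mul_le_mul_right ?_ hA
  calc Real.exp (-(1 - ε) * x) * (1 - G q) * (1 - F q) ^ (1 - ε)
      = (1 - G q) * ((1 - F q) ^ (1 - ε) * Real.exp (-(1 - ε) * x)) := by ring
    _ ≤ (1 - G q) * (1 - F z) ^ (1 - ε) := mul_le_mul_of_nonneg_left hpow hg.le
    _ ≤ (1 - G z) * (1 - F q) ^ (1 - ε) := hmono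

/-- If `F₀, F₁` satisfy `B(F₀,F₁)` with constants `ε ∈ (0,1)` and `x₀`, `q > x₀`, and
`X*` has the tail distribution function `(F₁)_q` linked with `F₁`, then
`Y = ln(1-F₀(q)) - ln(1-F₀(X*))` satisfies `P(Y ≤ x) ≤ 1 - e^{-(1-ε)x}` for `x ≥ 0`,
i.e. `Y` is stochastically larger than an exponential random variable with parameter
`1 - ε`. -/
theorem Y_stochastically_larger_exponential
    {Ω : Type*} [MeasurableSpace Ω] (P : Measure Ω) [IsProbabilityMeasure P]
    (F0 F1 : ℝ → ℝ) (hF0 : IsContinuousDF F0) (hF1 : IsContinuousDF F1)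
    (ε x₀ : ℝ) (hε : ε ∈ Set.Ioo (0 : ℝ) 1) (hB : CondB F0 F1 ε x₀)
    (q : ℝ) (hq : x₀ < q) (hF0q : F0 q < 1) (hF1q : F1 q < 1)
    (Xs : Ω → ℝ) (hsupp : ∀ ω, q < Xs ω)
    (hcdf : ∀ x, q < x → (P {ω | Xs ω ≤ x}).toReal = (F1 x - F1 q) / (1 - F1 q)) :
    ∀ x, 0 ≤ x →
      (P {ω | Real.log (1 - F0 q) - Real.log (1 - F0 (Xs ω)) ≤ x}).toReal ≤
        1 - Real.exp (-(1 - ε) * x) := by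
  intro x hx
  have ha : 0 < 1 - F0 q := sub_pos.mpr hF0q
  have hexp : Real.exp (-x) ≤ 1 := Real.exp_le_one_iff.mpr (neg_nonpos.mpr hx)
  have hcpos : 0 < (1 - F0 q) * Real.exp (-x) := mul_pos ha (Real.exp_pos _)
  obtain ⟨z, hqz, hFz, hmax⟩ := hF0.exists_sublevel_endpoint (q := q)
    (c := 1 - (1 - F0 q) * Real.exp (-x)) (by linarith)
    (by linarith [mul_le_of_le_one_right ha.le hexp])
  have hsub : {ω | Real.log (1 - F0 q) - Real.log (1 - F0 (Xs ω)) ≤ x} ⊆ {ω | Xs ω ≤ z} := by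
    intro ω hω
    have hω' : Real.log (1 - F0 q) - Real.log (1 - F0 (Xs ω)) ≤ x := hω
    have hlt := hB.lt_one hF0 hε.2 hq hF0q hF1q (hsupp ω).le
    have hlog : Real.log ((1 - F0 q) * Real.exp (-x)) ≤ Real.log (1 - F0 (Xs ω)) := by
      rw [Real.log_mul ha.ne' (Real.exp_pos _).ne', Real.log_exp]
      linarith
    have hle := (Real.log_le_log_iff hcpos (sub_pos.mpr hlt)).mp hlog
    exact hmax _ (by linarith)
  have hP : (P {ω | Xs ω ≤ z}).toReal = (F1 z - F1 q) / (1 - F1 q) := by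
    rcases hqz.eq_or_lt with rfl | h
    · have hempty : {ω | Xs ω ≤ q} = ∅ :=
        Set.eq_empty_of_forall_notMem fun ω hω => not_le.mpr (hsupp ω) hω
      simp [hempty]
    · exact hcdf z h
  have htail := hB.exp_le_tail_div (x := x) hε.2 hq hF0q hF1q hqz (by linarith)
  have hg : 1 - F1 q ≠ 0 := (sub_pos.mpr hF1q).ne'
  calc (P {ω | Real.log (1 - F0 q) - Real.log (1 - F0 (Xs ω)) ≤ x}).toReal
      ≤ (P {ω | Xs ω ≤ z}).toReal :=
        ENNReal.toReal_mono (measure_ne_top _ _) (measure_mono hsub)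
    _ = 1 - (1 - F1 z) / (1 - F1 q) := by rw [hP]; field_simp; ring
    _ ≤ 1 - Real.exp (-(1 - ε) * x) := by linarith
end

section
/- Let $F_0$ and $F_1$ be continuous distribution functions satisfying condition $C(F_0,F_1)$ with constants $\varepsilon > 0$ and $x_0$, and let $q > x_0$ with $F_0(q)<1$, $F_1(q)<1$ and $-\ln(1-F_0(q)) > 0$. Let $X^*$ be a random variable with the tail distribution function $(F_1)_q$ linked with $F_1$, and set $Y = \ln(1-F_0(q)) - \ln(1-F_0(X^*))$. Then $P(Y \le x) \le 1 - e^{-x}\big(1 + \frac{x}{-\ln(1-F_0(q))}\big)^{\varepsilon}$ for all $x \ge 0$. -/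
open MeasureTheory Filter

/-- Condition `C(F,G)` with constants `ε` and `x₀`:
`x ↦ (1 - G x) / ((1 - F x) (-ln(1 - F x))^ε)` is nondecreasing for `x > x₀`. -/
def CondC (F G : ℝ → ℝ) (ε x₀ : ℝ) : Prop :=
  MonotoneOn (fun x => (1 - G x) / ((1 - F x) * (-Real.log (1 - F x)) ^ ε)) (Set.Ioi x₀)

/-- A level between `F q` and `1` of a continuous distribution function is attained at a largest
point, which lies to the right of `q`. -/
theorem IsContinuousDF.exists_greatest_eq {F : ℝ → ℝ} (hF : IsContinuousDF F) {q c : ℝ}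
    (hqc : F q ≤ c) (hc : c < 1) : ∃ t, q ≤ t ∧ F t = c ∧ ∀ s, F s ≤ c → s ≤ t := by
  obtain ⟨hmono, hcont, -, htop⟩ := hF
  obtain ⟨M, hM⟩ := (htop.eventually (lt_mem_nhds hc)).exists
  have hbdd : BddAbove {s | F s ≤ c} :=
    ⟨M, fun s hs => (hmono.reflect_lt (lt_of_le_of_lt hs hM)).le⟩
  have hmem : sSup {s | F s ≤ c} ∈ {s | F s ≤ c} :=
    (isClosed_le hcont continuous_const).csSup_mem ⟨q, hqc⟩ hbdd
  obtain ⟨s, -, hs⟩ := intermediate_value_Icc (hmono.reflect_lt (hqc.trans_lt hM)).le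
    hcont.continuousOn ⟨hqc, hM.le⟩
  exact ⟨_, le_csSup hbdd hqc,
    le_antisymm hmem (hs.symm.le.trans (hmono (le_csSup hbdd hs.le))), fun s hs => le_csSup hbdd hs⟩

/-- Under `C(F,G)`, the distribution function `F` stays below `1` to the right of any point at
which the ratio in the condition is positive. -/
theorem CondC.lt_one {F G : ℝ → ℝ} {ε x₀ q t : ℝ} (hC : CondC F G ε x₀) (hF : Monotone F)
    (hq : x₀ < q) (hFq : F q < 1) (hGq : G q < 1) (hlog : 0 < -Real.log (1 - F q))
    (hF1 : F t ≤ 1) : F t < 1 := by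
  refine lt_of_le_of_ne hF1 fun h => ?_
  have hqt : q < t := hF.reflect_lt (h ▸ hFq)
  have hle := hC (Set.mem_Ioi.2 hq) (Set.mem_Ioi.2 (hq.trans hqt)) hqt.le
  have hpos : 0 < (1 - G q) / ((1 - F q) * (-Real.log (1 - F q)) ^ ε) :=
    div_pos (by linarith) (mul_pos (by linarith) (Real.rpow_pos_of_pos hlog ε))
  simp only [h, sub_self, zero_mul, div_zero] at hle
  exact absurd hle hpos.not_ge

/-- The comparison of the tails of `F` and `G` that `C(F,G)` gives at a point `t` where
`-ln(1 - F t)` exceeds `-ln(1 - F q)` by `x`. -/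
theorem CondC.exp_mul_rpow_le {F G : ℝ → ℝ} {ε x₀ q t x : ℝ} (hC : CondC F G ε x₀)
    (hq : x₀ < q) (hqt : q ≤ t) (hx : 0 ≤ x) (hFq : F q < 1) (hGq : G q < 1)
    (hlog : 0 < -Real.log (1 - F q)) (ht : 1 - F t = (1 - F q) * Real.exp (-x)) :
    Real.exp (-x) * (1 + x / (-Real.log (1 - F q))) ^ ε ≤ (1 - G t) / (1 - G q) := by
  have hle := hC (Set.mem_Ioi.2 hq) (Set.mem_Ioi.2 (hq.trans_le hqt)) hqt
  have hu : 0 < 1 - F q := by linarith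
  have hlogt : -Real.log (1 - F t) = -Real.log (1 - F q) + x := by
    rw [ht, Real.log_mul hu.ne' (Real.exp_pos _).ne', Real.log_exp]
    ring
  simp only [hlogt] at hle
  rw [ht] at hle
  generalize -Real.log (1 - F q) = L at *
  have hLx : 0 < L + x := by linarith
  have hG : 0 < 1 - G q := by linarith
  have hp := Real.rpow_pos_of_pos hlog ε
  have hpx := Real.rpow_pos_of_pos hLx ε
  have he := Real.exp_pos (-x)
  rw [div_le_div_iff₀ (by positivity) (by positivity)] at hle
  rw [show 1 + x / L = (L + x) / L by field_simp, Real.div_rpow hLx.le hlog.le,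
    ← mul_div_assoc, div_le_div_iff₀ hp hG]
  refine le_of_mul_le_mul_left ?_ hu
  linarith

/-- If `F₀, F₁` satisfy `C(F₀,F₁)` with constants `ε > 0` and `x₀`, `q > x₀` with
`-ln(1-F₀(q)) > 0`, and `X*` has the tail distribution function `(F₁)_q` linked with
`F₁`, then `Y = ln(1-F₀(q)) - ln(1-F₀(X*))` satisfies
`P(Y ≤ x) ≤ 1 - e^{-x} (1 + x/(-ln(1-F₀(q))))^ε` for all `x ≥ 0`. -/
theorem Y_tail_bound_condC
    {Ω : Type*} [MeasurableSpace Ω] (P : Measure Ω) [IsProbabilityMeasure P]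
    (F0 F1 : ℝ → ℝ) (hF0 : IsContinuousDF F0) (hF1 : IsContinuousDF F1)
    (ε x₀ : ℝ) (hε : 0 < ε) (hC : CondC F0 F1 ε x₀)
    (q : ℝ) (hq : x₀ < q) (hF0q : F0 q < 1) (hF1q : F1 q < 1)
    (hlog : 0 < -Real.log (1 - F0 q))
    (Xs : Ω → ℝ) (hsupp : ∀ ω, q < Xs ω)
    (hcdf : ∀ x, q < x → (P {ω | Xs ω ≤ x}).toReal = (F1 x - F1 q) / (1 - F1 q)) :
    ∀ x, 0 ≤ x →
      (P {ω | Real.log (1 - F0 q) - Real.log (1 - F0 (Xs ω)) ≤ x}).toReal ≤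
        1 - Real.exp (-x) * (1 + x / (-Real.log (1 - F0 q))) ^ ε := by
  intro x hx
  have hu : 0 < 1 - F0 q := by linarith
  have hle_one : ∀ t, F0 t ≤ 1 := fun t => hF0.1.ge_of_tendsto hF0.2.2.2 t
  have hexp : Real.exp (-x) ≤ 1 := Real.exp_le_one_iff.2 (by linarith)
  obtain ⟨t, hqt, ht, hmax⟩ := hF0.exists_greatest_eq
    (q := q) (c := 1 - (1 - F0 q) * Real.exp (-x))
    (by nlinarith) (by linarith [mul_pos hu (Real.exp_pos (-x))])
  have hsub : {ω | Real.log (1 - F0 q) - Real.log (1 - F0 (Xs ω)) ≤ x} ⊆ {ω | Xs ω ≤ t} := by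
    intro ω hω
    have hpos : 0 < 1 - F0 (Xs ω) :=
      sub_pos.2 (hC.lt_one hF0.1 hq hF0q hF1q hlog (hle_one _))
    refine hmax _ ?_
    have hlog_le : Real.log ((1 - F0 q) * Real.exp (-x)) ≤ Real.log (1 - F0 (Xs ω)) := by
      rw [Real.log_mul hu.ne' (Real.exp_pos _).ne', Real.log_exp]
      linarith [show _ ≤ x from hω]
    linarith [(Real.log_le_log_iff (mul_pos hu (Real.exp_pos _)) hpos).1 hlog_le]
  have hcdf_t : (P {ω | Xs ω ≤ t}).toReal = (F1 t - F1 q) / (1 - F1 q) := by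
    rcases hqt.eq_or_lt with rfl | hlt
    · have hempty : {ω | Xs ω ≤ q} = ∅ :=
        Set.eq_empty_of_forall_notMem fun ω hω => (hsupp ω).not_ge hω
      simp [hempty]
    · exact hcdf t hlt
  have htail := hC.exp_mul_rpow_le hq hqt hx hF0q hF1q hlog (by linarith)
  calc _ ≤ (P {ω | Xs ω ≤ t}).toReal :=
        ENNReal.toReal_mono (measure_ne_top _ _) (measure_mono hsub)
    _ = 1 - (1 - F1 t) / (1 - F1 q) := by
        rw [hcdf_t, eq_sub_iff_add_eq, ← add_div, div_eq_one_iff_eq (by linarith)]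
        ring
    _ ≤ _ := by linarith
end

section
/- For all $\varepsilon, c \in (0,1)$ and all $x \ge 0$, one has $(1+cx)^{\varepsilon} \ge 1 + c\varepsilon - c\varepsilon e^{-x}$. -/
theorem Real.one_sub_exp_neg_le_log_one_add {x : ℝ} (hx : 0 ≤ x) :
    1 - Real.exp (-x) ≤ Real.log (1 + x) := by
  have hlog := Real.le_log_one_add_of_nonneg hx
  have hexp : 1 - Real.exp (-x) ≤ 2 * x / (x + 2) := by
    rw [le_div_iff₀ (by linarith)]
    rcases le_or_gt 2 x with h | h
    · nlinarith [Real.exp_pos (-x)]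
    · have hd : 0 < 2 - x := by linarith
      have ht : 0 ≤ 2 * x / (2 - x) := by positivity
      have h1 := Real.le_log_one_add_of_nonneg ht
      have h2 : 2 * (2 * x / (2 - x)) / (2 * x / (2 - x) + 2) = x := by
        field_simp
        ring
      rw [h2, Real.le_log_iff_exp_le (by linarith)] at h1
      have h3 : 1 + 2 * x / (2 - x) = (2 + x) / (2 - x) := by
        field_simp
        ring
      rw [h3, le_div_iff₀ hd] at h1
      have h4 : Real.exp x * Real.exp (-x) = 1 := by
        rw [← Real.exp_add, add_neg_cancel, Real.exp_zero]
      have h5 := mul_le_mul_of_nonneg_right h1 (Real.exp_pos (-x)).le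
      have h6 : Real.exp x * (2 - x) * Real.exp (-x) = 2 - x := by
        linear_combination (2 - x) * h4
      linarith
  exact hexp.trans hlog

theorem Real.mul_log_one_add_le_log_one_add_mul {c x : ℝ} (hc₀ : 0 ≤ c) (hc₁ : c ≤ 1)
    (hx : 0 ≤ x) : c * Real.log (1 + x) ≤ Real.log (1 + c * x) := by
  rw [← Real.log_rpow (by linarith)]
  exact Real.log_le_log (by positivity)
    (rpow_one_add_le_one_add_mul_self (by linarith) hc₀ hc₁)

/-- For all `ε, c ∈ (0,1)` and all `x ≥ 0`, one has
`(1 + c x)^ε ≥ 1 + c ε - c ε e^{-x}` (with the real power). -/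
theorem one_add_mul_rpow_ge (ε c x : ℝ) (hε : ε ∈ Set.Ioo (0 : ℝ) 1)
    (hc : c ∈ Set.Ioo (0 : ℝ) 1) (hx : 0 ≤ x) :
    1 + c * ε - c * ε * Real.exp (-x) ≤ (1 + c * x) ^ ε := by
  have hpos : 0 < 1 + c * x := by nlinarith [mul_nonneg hc.1.le hx]
  have h1 := mul_le_mul_of_nonneg_left (Real.one_sub_exp_neg_le_log_one_add hx) hc.1.le
  have h2 := Real.mul_log_one_add_le_log_one_add_mul hc.1.le hc.2.le hx
  have h3 := mul_le_mul_of_nonneg_left (h1.trans h2) hε.1.le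
  rw [Real.rpow_def_of_pos hpos]
  linarith [Real.add_one_le_exp (Real.log (1 + c * x) * ε)]
end
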